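/- arXiv:1701.02076 — 3 statements merged into one kernel-verified Lean document; each statement's English description precedes it below -/
import Mathlib

section
/- For every n ≥ 2, the algebra H(S_n) admits a Hopf algebra structure over ℤ: there exist a ℤ-algebra homomorphism Δ : H(S_n) → H(S_n) ⊗_ℤ H(S_n), a ℤ-algebra homomorphism ε : H(S_n) → ℤ, and a ℤ-algebra anti-homomorphism S : H(S_n) → H(S_n) which make H(S_n) into a Hopf algebra over ℤ and satisfy, for all i = 1,…,n−1: Δ(s_i) = s_i ⊗ s_i, Δ(D_i) = D_i ⊗ 1 + s_i ⊗ D_i, ε(s_i) = 1, ε(D_i) = 0, S(s_i) = s_i, S(D_i) = −s_i·D_i. -/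
open scoped TensorProduct

namespace HeckeHopfSn

/-- Generators of the Hecke-Hopf algebra `H(Sₙ)`: `s i` and `D i` for `i = 1, …, n-1`. -/
inductive Gen (n : ℕ) : Type
  | s : Fin (n - 1) → Gen n
  | D : Fin (n - 1) → Gen n

/-- The free `ℤ`-algebra on the generators. -/
abbrev F (n : ℕ) : Type := FreeAlgebra ℤ (Gen n)

noncomputable def fs (n : ℕ) (i : Fin (n - 1)) : F n := FreeAlgebra.ι ℤ (Gen.s i)
noncomputable def fD (n : ℕ) (i : Fin (n - 1)) : F n := FreeAlgebra.ι ℤ (Gen.D i)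

/-- `|i - j| = 1`. -/
def Adj (n : ℕ) (i j : Fin (n - 1)) : Prop := (i : ℕ) + 1 = (j : ℕ) ∨ (j : ℕ) + 1 = (i : ℕ)

/-- `|i - j| > 1`. -/
def Dist (n : ℕ) (i j : Fin (n - 1)) : Prop := (i : ℕ) + 1 < (j : ℕ) ∨ (j : ℕ) + 1 < (i : ℕ)

/-- The defining relations of `H(Sₙ)`. -/
inductive Rel (n : ℕ) : F n → F n → Prop
  | s_sq (i : Fin (n - 1)) : Rel n (fs n i * fs n i) 1
  | sD (i : Fin (n - 1)) : Rel n (fs n i * fD n i + fD n i * fs n i) (fs n i - 1)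
  | D_sq (i : Fin (n - 1)) : Rel n (fD n i * fD n i) (fD n i)
  | ss (i j : Fin (n - 1)) : Dist n i j → Rel n (fs n j * fs n i) (fs n i * fs n j)
  | Ds (i j : Fin (n - 1)) : Dist n i j → Rel n (fD n j * fs n i) (fs n i * fD n j)
  | DD (i j : Fin (n - 1)) : Dist n i j → Rel n (fD n j * fD n i) (fD n i * fD n j)
  | braid (i j : Fin (n - 1)) : Adj n i j →
      Rel n (fs n j * fs n i * fs n j) (fs n i * fs n j * fs n i)
  | braidDs (i j : Fin (n - 1)) : Adj n i j →
      Rel n (fD n i * fs n j * fs n i) (fs n j * fs n i * fD n j)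
  | braidDsD (i j : Fin (n - 1)) : Adj n i j →
      Rel n (fD n j * fs n i * fD n j)
        (fs n i * fD n j * fD n i + fD n i * fD n j * fs n i + fs n i * fD n j * fs n i)

/-- The Hecke-Hopf algebra `H(Sₙ)` of the symmetric group `Sₙ`. -/
abbrev HH (n : ℕ) : Type := RingQuot (Rel n)

/-- The image of the generator `sᵢ` in `H(Sₙ)`. -/
noncomputable def sg (n : ℕ) (i : Fin (n - 1)) : HH n := RingQuot.mkAlgHom ℤ (Rel n) (fs n i)

/-- The image of the generator `Dᵢ` in `H(Sₙ)`. -/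
noncomputable def dg (n : ℕ) (i : Fin (n - 1)) : HH n := RingQuot.mkAlgHom ℤ (Rel n) (fD n i)

/-- A Hopf algebra structure on an `R`-algebra `A`: an algebra-homomorphism
comultiplication and counit and an anti-homomorphism antipode, satisfying the
coassociativity, counit and antipode axioms. -/
structure HopfAlgStruct (R : Type*) (A : Type*) [CommRing R] [Ring A] [Algebra R A] where
  comul : A →ₐ[R] A ⊗[R] A
  counit : A →ₐ[R] R
  antipode : A →ₗ[R] A
  antipode_one : antipode 1 = 1
  antipode_mul : ∀ x y : A, antipode (x * y) = antipode y * antipode x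
  coassoc : ∀ x : A,
    (TensorProduct.assoc R A A A) ((Algebra.TensorProduct.map comul (AlgHom.id R A)) (comul x)) =
      (Algebra.TensorProduct.map (AlgHom.id R A) comul) (comul x)
  counit_comul : ∀ x : A,
    (TensorProduct.lid R A) ((LinearMap.rTensor A counit.toLinearMap) (comul x)) = x
  comul_counit : ∀ x : A,
    (TensorProduct.rid R A) ((LinearMap.lTensor A counit.toLinearMap) (comul x)) = x
  mul_antipode_rTensor_comul : ∀ x : A,
    (LinearMap.mul' R A) ((LinearMap.rTensor A antipode) (comul x)) = algebraMap R A (counit x)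
  mul_antipode_lTensor_comul : ∀ x : A,
    (LinearMap.mul' R A) ((LinearMap.lTensor A antipode) (comul x)) = algebraMap R A (counit x)

/-- The image under the antipode of the relation `DⱼsᵢDⱼ = sᵢDⱼDᵢ + DᵢDⱼsᵢ + sᵢDⱼsᵢ`. -/
lemma antipode_braid_relation {A : Type*} [Ring A] {s d t e : A}
    (hb : t * s * t = s * t * s) (hs : s * s = 1) (hi : s * d + d * s = s - 1)
    (h₁ : d * t * s = t * s * e) (h₂ : e * s * t = s * t * d)
    (h₃ : e * s * e = s * e * d + d * e * s + s * e * s) :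
    -(t * e) * (s * -(t * e)) =
      -(s * d) * (-(t * e) * s) + s * (-(t * e) * -(s * d)) + s * (-(t * e) * s) := by
  have hdt : d * t = t * s * e * s := by
    rw [← h₁, mul_assoc (d * t), hs, mul_one]
  have hl : t * e * s * t * e = s * t * s * (d * e) := by
    calc t * e * s * t * e = t * (e * s * t) * e := by noncomm_ring
      _ = t * s * t * (d * e) := by rw [h₂]; noncomm_ring
      _ = _ := by rw [hb]
  have hm : s * d * t * e * s =
      s * t * s * (s * e * d * s + d * e + s * e) := by
    calc s * d * t * e * s = s * (d * t) * e * s := by noncomm_ring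
      _ = s * t * s * (e * s * e) * s := by rw [hdt]; noncomm_ring
      _ = s * t * s * (s * e * d * s + d * e * (s * s) + s * e * (s * s)) := by
        rw [h₃]; noncomm_ring
      _ = _ := by rw [hs, mul_one, mul_one]
  have hr : s * t * e = s * t * s * (s * e) := by
    rw [← mul_assoc, mul_assoc (s * t), hs, mul_one]
  calc -(t * e) * (s * -(t * e)) = t * e * s * t * e := by noncomm_ring
    _ = s * t * s * (s * e * (s * d + d * s) + d * e + s * e - s * e * s) := by
      rw [hl, hi]; noncomm_ring
    _ = s * d * t * e * s + s * t * e * s * d - s * t * e * s := by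
      rw [hm, hr]; noncomm_ring
    _ = _ := by noncomm_ring

section Realizes

variable {n : ℕ}

lemma Adj.symm {i j : Fin (n - 1)} (h : Adj n i j) : Adj n j i := Or.symm h

lemma Dist.symm {i j : Fin (n - 1)} (h : Dist n i j) : Dist n j i := Or.symm h

/-- Elements `s i`, `d i` of a ring satisfying the defining relations of `H(Sₙ)`. -/
structure Realizes {B : Type*} [Ring B] (s d : Fin (n - 1) → B) : Prop where
  s_sq (i) : s i * s i = 1
  sD (i) : s i * d i + d i * s i = s i - 1
  D_sq (i) : d i * d i = d i
  ss (i j) : Dist n i j → s j * s i = s i * s j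
  Ds (i j) : Dist n i j → d j * s i = s i * d j
  DD (i j) : Dist n i j → d j * d i = d i * d j
  braid (i j) : Adj n i j → s j * s i * s j = s i * s j * s i
  braidDs (i j) : Adj n i j → d i * s j * s i = s j * s i * d j
  braidDsD (i j) : Adj n i j →
    d j * s i * d j = s i * d j * d i + d i * d j * s i + s i * d j * s i

lemma realizes_counit {B : Type*} [Ring B] :
    Realizes (n := n) (fun _ => (1 : B)) (fun _ => 0) := by
  constructor <;> simp

variable {R A : Type*} [CommRing R] [Ring A] [Algebra R A] {s d : Fin (n - 1) → A}

open Algebra.TensorProduct in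
lemma Realizes.comul (H : Realizes s d) : Realizes (fun i => s i ⊗ₜ[R] s i)
    (fun i => d i ⊗ₜ[R] (1 : A) + s i ⊗ₜ[R] d i) where
  s_sq i := by simp only [tmul_mul_tmul, H.s_sq, one_def]
  sD i := by
    have h : s i * d i = s i - 1 - d i * s i := eq_sub_of_add_eq (H.sD i)
    simp only [mul_add, add_mul, tmul_mul_tmul, H.s_sq, one_def, mul_one, one_mul, h,
      TensorProduct.tmul_sub, TensorProduct.sub_tmul]
    abel
  D_sq i := by
    have h : s i * d i = s i - 1 - d i * s i := eq_sub_of_add_eq (H.sD i)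
    simp only [mul_add, add_mul, tmul_mul_tmul, H.s_sq, H.D_sq, mul_one, one_mul, h,
      TensorProduct.sub_tmul]
    abel
  ss i j h := by simp only [tmul_mul_tmul, H.ss i j h]
  Ds i j h := by
    simp only [mul_add, add_mul, tmul_mul_tmul, H.ss i j h, H.Ds i j h, mul_one, one_mul]
  DD i j h := by
    simp only [mul_add, add_mul, tmul_mul_tmul, H.ss i j h, H.Ds i j h, H.DD i j h,
      H.Ds j i h.symm, mul_one, one_mul]
    abel
  braid i j h := by simp only [tmul_mul_tmul, H.braid i j h]
  braidDs i j h := by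
    simp only [mul_add, add_mul, tmul_mul_tmul, H.braid i j h, H.braidDs i j h,
      mul_one, one_mul]
  braidDsD i j h := by
    have hi : s i * d i = s i - 1 - d i * s i := eq_sub_of_add_eq (H.sD i)
    simp only [mul_add, add_mul, tmul_mul_tmul, H.braid i j h, H.braidDs i j h,
      H.braidDs j i h.symm, H.braidDsD i j h, mul_one, one_mul, H.s_sq, hi,
      TensorProduct.tmul_add, TensorProduct.add_tmul, TensorProduct.tmul_sub]
    abel

open MulOpposite in
lemma Realizes.antipode (H : Realizes s d) : Realizes (fun i => op (s i))
    (fun i => op (-(s i * d i))) where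
  s_sq i := by simp only [← op_mul, H.s_sq, op_one]
  sD i := by
    simp only [← op_mul, ← op_add, ← op_sub, ← op_one, op_inj]
    linear_combination (norm := noncomm_ring)
      -H.sD i * s i - H.s_sq i * d i + d i * H.s_sq i - H.s_sq i
  D_sq i := by
    simp only [← op_mul, op_inj]
    linear_combination (norm := noncomm_ring) s i * H.sD i * d i - s i * s i * H.D_sq i
  ss i j h := by simp only [← op_mul, H.ss i j h]
  Ds i j h := by
    simp only [← op_mul, op_inj]
    linear_combination (norm := noncomm_ring) s j * H.Ds i j h + H.ss i j h * d j
  DD i j h := by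
    simp only [← op_mul, op_inj]
    linear_combination (norm := noncomm_ring) s i * H.Ds j i h.symm * d j -
      s j * H.Ds i j h * d i - H.ss i j h * d i * d j - s j * s i * H.DD i j h
  braid i j h := by simp only [← op_mul, ← mul_assoc, H.braid i j h]
  braidDs i j h := by
    simp only [← op_mul, op_inj]
    linear_combination (norm := noncomm_ring) s j * H.braidDs j i h.symm + H.braid i j h * d i
  braidDsD i j h := by
    simp only [← op_mul, ← op_add, op_inj]
    exact antipode_braid_relation (H.braid i j h) (H.s_sq i) (H.sD i) (H.braidDs i j h)
      (H.braidDs j i h.symm) (H.braidDsD i j h)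

end Realizes

section Antipode

variable {R A : Type*} [CommRing R] [Ring A] [Algebra R A] {S : A →ₗ[R] A}

lemma mul'_rTensor_mul_tmul (hS : ∀ x y, S (x * y) = S y * S x) (t : A ⊗[R] A) (c d : A) :
    LinearMap.mul' R A (S.rTensor A (t * c ⊗ₜ d)) =
      S c * LinearMap.mul' R A (S.rTensor A t) * d := by
  induction t with
  | zero => simp
  | tmul a b => simp [hS, mul_assoc]
  | add t u ht hu => simp only [add_mul, map_add, mul_add, ht, hu]

lemma mul'_lTensor_tmul_mul (hS : ∀ x y, S (x * y) = S y * S x) (t : A ⊗[R] A) (a b : A) :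
    LinearMap.mul' R A (S.lTensor A (a ⊗ₜ b * t)) =
      a * LinearMap.mul' R A (S.lTensor A t) * S b := by
  induction t with
  | zero => simp
  | tmul c d => simp [hS, mul_assoc]
  | add t u ht hu => simp only [add_mul, map_add, mul_add, ht, hu]

lemma mul'_rTensor_mul (hS : ∀ x y, S (x * y) = S y * S x) {t : A ⊗[R] A} {r : R}
    (ht : LinearMap.mul' R A (S.rTensor A t) = algebraMap R A r) (u : A ⊗[R] A) :
    LinearMap.mul' R A (S.rTensor A (t * u)) =
      algebraMap R A r * LinearMap.mul' R A (S.rTensor A u) := by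
  induction u with
  | zero => simp
  | tmul c d =>
    rw [mul'_rTensor_mul_tmul hS, ht, ← Algebra.commutes, mul_assoc]
    simp
  | add u v hu hv => simp only [map_add, mul_add, hu, hv]

lemma mul'_lTensor_mul (hS : ∀ x y, S (x * y) = S y * S x) {u : A ⊗[R] A} {r : R}
    (hu : LinearMap.mul' R A (S.lTensor A u) = algebraMap R A r) (t : A ⊗[R] A) :
    LinearMap.mul' R A (S.lTensor A (t * u)) =
      LinearMap.mul' R A (S.lTensor A t) * algebraMap R A r := by
  induction t with
  | zero => simp
  | tmul a b =>
    rw [mul'_lTensor_tmul_mul hS, hu, mul_assoc, Algebra.commutes, ← mul_assoc]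
    simp
  | add t v ht hv => simp only [map_add, add_mul, ht, hv]

end Antipode

section Presentation

universe u

variable {n : ℕ} {R A : Type u} [CommRing R] [Ring A] [Algebra R A]

/-- The `R`-algebra `A` is presented by the generators `s i`, `d i` and the defining relations
of `H(Sₙ)`. -/
structure IsPresentedBy (R : Type u) [CommRing R] [Algebra R A] (s d : Fin (n - 1) → A) :
    Prop where
  realizes : Realizes s d
  exists_lift {B : Type u} [Ring B] [Algebra R B] {s' d' : Fin (n - 1) → B} :
    Realizes s' d' → ∃ f : A →ₐ[R] B, (∀ i, f (s i) = s' i) ∧ ∀ i, f (d i) = d' i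
  adjoin_eq_top : Algebra.adjoin R (Set.range s ∪ Set.range d) = ⊤

namespace IsPresentedBy

variable {s d : Fin (n - 1) → A}

lemma algHom_ext (P : IsPresentedBy R s d) {B : Type*} [Ring B] [Algebra R B]
    {f g : A →ₐ[R] B} (hs : ∀ i, f (s i) = g (s i)) (hd : ∀ i, f (d i) = g (d i)) : f = g := by
  refine AlgHom.ext_of_adjoin_eq_top P.adjoin_eq_top ?_
  rintro _ (⟨i, rfl⟩ | ⟨i, rfl⟩)
  · exact hs i
  · exact hd i

lemma induction (P : IsPresentedBy R s d) {p : A → Prop}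
    (halg : ∀ r : R, p (algebraMap R A r)) (hs : ∀ i, p (s i)) (hd : ∀ i, p (d i))
    (hmul : ∀ x y, p x → p y → p (x * y)) (hadd : ∀ x y, p x → p y → p (x + y)) (x : A) :
    p x := by
  have hx : x ∈ Algebra.adjoin R (Set.range s ∪ Set.range d) := P.adjoin_eq_top ▸ trivial
  induction hx using Algebra.adjoin_induction with
  | mem x hx =>
    obtain ⟨i, rfl⟩ | ⟨i, rfl⟩ := hx
    · exact hs i
    · exact hd i
  | algebraMap r => exact halg r
  | add x y _ _ hx hy => exact hadd x y hx hy
  | mul x y _ _ hx hy => exact hmul x y hx hy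

theorem exists_hopfAlgStruct (P : IsPresentedBy R s d) :
    ∃ H : HopfAlgStruct R A,
      (∀ i, H.comul (s i) = s i ⊗ₜ[R] s i) ∧
      (∀ i, H.comul (d i) = d i ⊗ₜ[R] 1 + s i ⊗ₜ[R] d i) ∧
      (∀ i, H.counit (s i) = 1) ∧
      (∀ i, H.counit (d i) = 0) ∧
      (∀ i, H.antipode (s i) = s i) ∧
      (∀ i, H.antipode (d i) = -(s i * d i)) := by
  obtain ⟨Δ, hΔs, hΔd⟩ := P.exists_lift (P.realizes.comul (R := R))
  obtain ⟨ε, hεs, hεd⟩ := P.exists_lift (realizes_counit (B := R))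
  obtain ⟨T, hTs, hTd⟩ := P.exists_lift P.realizes.antipode
  let S : A →ₗ[R] A := (MulOpposite.opLinearEquiv R).symm.toLinearMap ∘ₗ T.toLinearMap
  have hSs (i) : S (s i) = s i := by simp [S, hTs]
  have hSd (i) : S (d i) = -(s i * d i) := by simp [S, hTd]
  have hS1 : S 1 = 1 := by simp [S]
  have hSa (r : R) : S (algebraMap R A r) = algebraMap R A r := by simp [S]
  have hSm (x y) : S (x * y) = S y * S x := by simp [S]
  refine ⟨⟨Δ, ε, S, hS1, hSm, fun x => ?_, fun x => ?_, fun x => ?_, fun x => ?_, fun x => ?_⟩,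
    hΔs, hΔd, hεs, hεd, hSs, hSd⟩
  · refine DFunLike.congr_fun (P.algHom_ext
      (f := ((Algebra.TensorProduct.assoc R R R A A A).toAlgHom.comp
        (Algebra.TensorProduct.map Δ (AlgHom.id R A))).comp Δ)
      (g := (Algebra.TensorProduct.map (AlgHom.id R A) Δ).comp Δ) (fun i => ?_) fun i => ?_) x
    · simp [hΔs]
    · simp [hΔs, hΔd, TensorProduct.add_tmul, TensorProduct.tmul_add, add_assoc,
        Algebra.TensorProduct.one_def]
  · refine DFunLike.congr_fun (P.algHom_ext
      (f := ((Algebra.TensorProduct.lid R A).toAlgHom.comp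
        (Algebra.TensorProduct.map ε (AlgHom.id R A))).comp Δ)
      (g := AlgHom.id R A) (fun i => ?_) fun i => ?_) x
    · simp [hΔs, hεs]
    · simp [hΔd, hεs, hεd]
  · refine DFunLike.congr_fun (P.algHom_ext
      (f := ((Algebra.TensorProduct.rid R R A).toAlgHom.comp
        (Algebra.TensorProduct.map (AlgHom.id R A) ε)).comp Δ)
      (g := AlgHom.id R A) (fun i => ?_) fun i => ?_) x
    · simp [hΔs, hεs]
    · simp [hΔd, hεd]
  · induction x using P.induction with
    | halg r =>
      rw [AlgHom.commutes, AlgHom.commutes, Algebra.TensorProduct.algebraMap_apply]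
      simp [hSa]
    | hs i => simp [hΔs, hεs, hSs, P.realizes.s_sq]
    | hd i => simp [hΔd, hεd, hSs, hSd]
    | hmul x y hx hy => rw [map_mul, mul'_rTensor_mul hSm hx, hy, map_mul, map_mul]
    | hadd x y hx hy => simp only [map_add, hx, hy]
  · induction x using P.induction with
    | halg r =>
      rw [AlgHom.commutes, AlgHom.commutes, Algebra.TensorProduct.algebraMap_apply]
      simp [hS1]
    | hs i => simp [hΔs, hεs, hSs, P.realizes.s_sq]
    | hd i => simp [hΔd, hεd, hS1, hSd, ← mul_assoc, P.realizes.s_sq]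
    | hmul x y hx hy => rw [map_mul, mul'_lTensor_mul hSm hy, hx, map_mul, map_mul]
    | hadd x y hx hy => simp only [map_add, hx, hy]

end IsPresentedBy

end Presentation

lemma realizes_sg_dg (n : ℕ) : Realizes (sg n) (dg n) where
  s_sq i := by simpa [sg] using RingQuot.mkAlgHom_rel ℤ (Rel.s_sq i)
  sD i := by simpa [sg, dg] using RingQuot.mkAlgHom_rel ℤ (Rel.sD i)
  D_sq i := by simpa [dg] using RingQuot.mkAlgHom_rel ℤ (Rel.D_sq i)
  ss i j h := by simpa [sg] using RingQuot.mkAlgHom_rel ℤ (Rel.ss i j h)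
  Ds i j h := by simpa [sg, dg] using RingQuot.mkAlgHom_rel ℤ (Rel.Ds i j h)
  DD i j h := by simpa [dg] using RingQuot.mkAlgHom_rel ℤ (Rel.DD i j h)
  braid i j h := by simpa [sg] using RingQuot.mkAlgHom_rel ℤ (Rel.braid i j h)
  braidDs i j h := by simpa [sg, dg] using RingQuot.mkAlgHom_rel ℤ (Rel.braidDs i j h)
  braidDsD i j h := by simpa [sg, dg] using RingQuot.mkAlgHom_rel ℤ (Rel.braidDsD i j h)

lemma isPresentedBy_sg_dg (n : ℕ) : IsPresentedBy ℤ (sg n) (dg n) where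
  realizes := realizes_sg_dg n
  exists_lift {B} _ _ s' d' h := by
    refine ⟨RingQuot.liftAlgHom ℤ ⟨FreeAlgebra.lift ℤ (Gen.rec s' d'), fun x y hxy => ?_⟩,
      fun i => ?_, fun i => ?_⟩
    · cases hxy <;>
        simp only [fs, fD, map_mul, map_add, map_sub, map_one, FreeAlgebra.lift_ι_apply]
      case s_sq i => exact h.s_sq i
      case sD i => exact h.sD i
      case D_sq i => exact h.D_sq i
      case ss i j hij => exact h.ss i j hij
      case Ds i j hij => exact h.Ds i j hij
      case DD i j hij => exact h.DD i j hij
      case braid i j hij => exact h.braid i j hij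
      case braidDs i j hij => exact h.braidDs i j hij
      case braidDsD i j hij => exact h.braidDsD i j hij
    · simp [sg, fs]
    · simp [dg, fD]
  adjoin_eq_top := by
    have hr : Set.range (sg n) ∪ Set.range (dg n) =
        RingQuot.mkAlgHom ℤ (Rel n) '' Set.range (FreeAlgebra.ι ℤ) := by
      ext x
      constructor
      · rintro (⟨i, rfl⟩ | ⟨i, rfl⟩)
        · exact ⟨_, ⟨Gen.s i, rfl⟩, rfl⟩
        · exact ⟨_, ⟨Gen.D i, rfl⟩, rfl⟩
      · rintro ⟨_, ⟨i | i, rfl⟩, rfl⟩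
        · exact Or.inl ⟨i, rfl⟩
        · exact Or.inr ⟨i, rfl⟩
    rw [hr, ← AlgHom.map_adjoin, FreeAlgebra.adjoin_range_ι, Algebra.map_top,
      AlgHom.range_eq_top]
    exact RingQuot.mkAlgHom_surjective ℤ (Rel n)

/-- For every `n ≥ 2`, `H(Sₙ)` admits a Hopf algebra structure over `ℤ`
with `Δ(sᵢ) = sᵢ ⊗ sᵢ`, `Δ(Dᵢ) = Dᵢ ⊗ 1 + sᵢ ⊗ Dᵢ`, `ε(sᵢ) = 1`, `ε(Dᵢ) = 0`,
`S(sᵢ) = sᵢ`, `S(Dᵢ) = -sᵢ·Dᵢ`. -/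
theorem hopf_structure_on_HH (n : ℕ) (hn : 2 ≤ n) :
    ∃ H : HopfAlgStruct ℤ (HH n),
      (∀ i : Fin (n - 1), H.comul (sg n i) = sg n i ⊗ₜ[ℤ] sg n i) ∧
      (∀ i : Fin (n - 1), H.comul (dg n i) = dg n i ⊗ₜ[ℤ] 1 + sg n i ⊗ₜ[ℤ] dg n i) ∧
      (∀ i : Fin (n - 1), H.counit (sg n i) = 1) ∧
      (∀ i : Fin (n - 1), H.counit (dg n i) = 0) ∧
      (∀ i : Fin (n - 1), H.antipode (sg n i) = sg n i) ∧
      (∀ i : Fin (n - 1), H.antipode (dg n i) = -(sg n i * dg n i)) := by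
  exact (isPresentedBy_sg_dg n).exists_hopfAlgStruct

end HeckeHopfSn
end

section
/- For every n ≥ 2 there exists a unique family of elements D_{ij} ∈ H(S_n), indexed by pairs 1 ≤ i < j ≤ n, such that D_{i,i+1} = D_i for all i = 1,…,n−1, and π(w)·D_{ij}·π(w)⁻¹ = D_{w(i),w(j)} for every permutation w ∈ S_n and every pair i < j with w(i) < w(j). -/
open scoped TensorProduct

namespace HeckeHopfSn

/-- The element `i` of `{1, …, n}`, for `i ∈ {1, …, n-1}`. -/
def finA (n : ℕ) (i : Fin (n - 1)) : Fin n := ⟨(i : ℕ), by have h := i.2; omega⟩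

/-- The element `i + 1` of `{1, …, n}`, for `i ∈ {1, …, n-1}`. -/
def finB (n : ℕ) (i : Fin (n - 1)) : Fin n := ⟨(i : ℕ) + 1, by have h := i.2; omega⟩

/-- Pairs `(i, j)` with `1 ≤ i < j ≤ n`. -/
def PairLT (n : ℕ) : Type := {p : Fin n × Fin n // p.1 < p.2}

/-- The pair `(i, i+1)`. -/
def pairOf (n : ℕ) (i : Fin (n - 1)) : PairLT n :=
  ⟨(finA n i, finB n i), by simp [finA, finB, Fin.lt_def]⟩

theorem sg_mul_self (n : ℕ) (i : Fin (n - 1)) : sg n i * sg n i = 1 := by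
  simpa [sg] using RingQuot.mkAlgHom_rel ℤ (Rel.s_sq i)

theorem commute_sg_dg {n : ℕ} {i j : Fin (n - 1)} (h : Dist n i j) :
    Commute (sg n i) (dg n j) := by
  have key := RingQuot.mkAlgHom_rel ℤ (Rel.Ds i j h)
  simp only [map_mul] at key
  exact key.symm

theorem dg_mul_sg_mul_sg {n : ℕ} {i j : Fin (n - 1)} (h : Adj n i j) :
    dg n i * sg n j * sg n i = sg n j * sg n i * dg n j := by
  simpa [sg, dg] using RingQuot.mkAlgHom_rel ℤ (Rel.braidDs i j h)

theorem exists_perm_map_pair {α : Type*} [DecidableEq α] {x y a b : α} (hxy : x ≠ y)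
    (hab : a ≠ b) : ∃ w : Equiv.Perm α, w x = a ∧ w y = b := by
  refine ⟨Equiv.swap (Equiv.swap x a y) b * Equiv.swap x a, ?_, ?_⟩
  · rw [Equiv.Perm.mul_apply, Equiv.swap_apply_left]
    refine Equiv.swap_apply_of_ne_of_ne (fun h => hxy ?_) hab
    apply (Equiv.swap x a).injective
    rw [← h, Equiv.swap_apply_left]
  · rw [Equiv.Perm.mul_apply, Equiv.swap_apply_left]

/-- The first index in `{1, …, n-1}`. -/
def firstIndex {n : ℕ} (hn : 2 ≤ n) : Fin (n - 1) := ⟨0, by omega⟩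

theorem commute_swap_dg_first {n : ℕ} (hn : 2 ≤ n) {π : Equiv.Perm (Fin n) →* (HH n)ˣ}
    (hπ : ∀ i : Fin (n - 1),
      ((π (Equiv.swap (finA n i) (finB n i)) : (HH n)ˣ) : HH n) = sg n i)
    {a b : Fin n} (ha : 2 ≤ (a : ℕ)) (hab : a < b) :
    Commute (π (Equiv.swap a b) : HH n) (dg n (firstIndex hn)) := by
  obtain ⟨b, hb⟩ := b
  induction b with
  | zero => simp [Fin.lt_def] at hab
  | succ b ih =>
    have hs : Commute (π (Equiv.swap (⟨b, by omega⟩ : Fin n) ⟨b + 1, hb⟩) : HH n)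
        (dg n (firstIndex hn)) := by
      have hab' : (a : ℕ) < b + 1 := hab
      have h := hπ ⟨b, by omega⟩
      simp only [finA, finB] at h
      rw [h]
      exact commute_sg_dg (Or.inr (by simp only [firstIndex]; omega))
    rcases (Nat.lt_succ_iff.mp hab : (a : ℕ) ≤ b).eq_or_lt with h | h
    · have hab' : a = ⟨b, by omega⟩ := Fin.ext h
      rwa [hab']
    · have key : Equiv.swap a ⟨b + 1, hb⟩ =
          Equiv.swap (⟨b, by omega⟩ : Fin n) ⟨b + 1, hb⟩ * Equiv.swap a ⟨b, by omega⟩ *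
            Equiv.swap (⟨b, by omega⟩ : Fin n) ⟨b + 1, hb⟩ := by
        rw [Equiv.swap_mul_swap_mul_swap (Fin.ne_of_lt h) hab.ne, Equiv.swap_comm]
      rw [key, map_mul, map_mul, Units.val_mul, Units.val_mul]
      exact (hs.mul_left (ih (by omega) h)).mul_left hs

theorem commute_dg_first_of_fixes {n : ℕ} (hn : 2 ≤ n) {π : Equiv.Perm (Fin n) →* (HH n)ˣ}
    (hπ : ∀ i : Fin (n - 1),
      ((π (Equiv.swap (finA n i) (finB n i)) : (HH n)ˣ) : HH n) = sg n i)
    {w : Equiv.Perm (Fin n)}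
    (hA : w (finA n (firstIndex hn)) = finA n (firstIndex hn))
    (hB : w (finB n (firstIndex hn)) = finB n (firstIndex hn)) :
    Commute (π w : HH n) (dg n (firstIndex hn)) := by
  have hfix : ∀ x : Fin n, w x ≠ x → 2 ≤ (x : ℕ) := by
    intro x hx
    by_contra! hlt
    have : x = finA n (firstIndex hn) ∨ x = finB n (firstIndex hn) := by
      simp only [Fin.ext_iff, finA, finB, firstIndex]; omega
    rcases this with rfl | rfl
    exacts [hx hA, hx hB]
  have hmem : ∀ x : Fin n, 2 ≤ (w x : ℕ) ↔ 2 ≤ (x : ℕ) := by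
    intro x
    by_cases hx : w x = x
    · rw [hx]
    · exact iff_of_true (hfix _ fun h => hx (w.injective h)) (hfix x hx)
  rw [← Equiv.Perm.ofSubtype_subtypePerm (p := fun x : Fin n => 2 ≤ (x : ℕ)) hmem hfix]
  induction w.subtypePerm (p := fun x : Fin n => 2 ≤ (x : ℕ)) hmem using Equiv.Perm.swap_induction_on with
  | one => simp
  | swap_mul f x y hxy ih =>
    rw [map_mul, map_mul, Units.val_mul, Equiv.Perm.ofSubtype_swap_eq]
    refine Commute.mul_left ?_ ih
    rcases lt_or_gt_of_ne hxy with h | h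
    · exact commute_swap_dg_first hn hπ x.2 h
    · rw [Equiv.swap_comm]
      exact commute_swap_dg_first hn hπ y.2 h

theorem conj_dg_first_eq {n : ℕ} (hn : 2 ≤ n) {π : Equiv.Perm (Fin n) →* (HH n)ˣ}
    (hπ : ∀ i : Fin (n - 1),
      ((π (Equiv.swap (finA n i) (finB n i)) : (HH n)ˣ) : HH n) = sg n i)
    {v w : Equiv.Perm (Fin n)}
    (hA : v (finA n (firstIndex hn)) = w (finA n (firstIndex hn)))
    (hB : v (finB n (firstIndex hn)) = w (finB n (firstIndex hn))) :
    (π v : HH n) * dg n (firstIndex hn) * (((π v)⁻¹ : (HH n)ˣ) : HH n) =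
      (π w : HH n) * dg n (firstIndex hn) * (((π w)⁻¹ : (HH n)ˣ) : HH n) := by
  have h : Commute (π (w⁻¹ * v) : HH n) (dg n (firstIndex hn)) :=
    commute_dg_first_of_fixes hn hπ (by simp [hA]) (by simp [hB])
  have hv : π v = π w * π (w⁻¹ * v) := by simp
  rw [hv, Units.val_mul, mul_assoc (π w : HH n), h.eq, mul_inv_rev, Units.val_mul]
  simp only [mul_assoc, Units.mul_inv_cancel_left]

theorem exists_conj_dg_first_eq_dg {n : ℕ} (hn : 2 ≤ n) {π : Equiv.Perm (Fin n) →* (HH n)ˣ}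
    (hπ : ∀ i : Fin (n - 1),
      ((π (Equiv.swap (finA n i) (finB n i)) : (HH n)ˣ) : HH n) = sg n i)
    (i : Fin (n - 1)) :
    ∃ w : Equiv.Perm (Fin n), w (finA n (firstIndex hn)) = finA n i ∧
      w (finB n (firstIndex hn)) = finB n i ∧
      (π w : HH n) * dg n (firstIndex hn) = dg n i * (π w : HH n) := by
  obtain ⟨i, hi⟩ := i
  induction i with
  | zero => exact ⟨1, by simp [firstIndex]⟩
  | succ i ih =>
    obtain ⟨w, hA, hB, hw⟩ := ih (by omega)
    set x : Fin (n - 1) := ⟨i, by omega⟩ with hx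
    set y : Fin (n - 1) := ⟨i + 1, hi⟩ with hy
    have hAy : finA n y = finB n x := rfl
    have hxx : finA n x ≠ finB n x := by simp [finA, finB]
    have hxy : finA n x ≠ finB n y := by simp [finA, finB, hx, hy]; omega
    have hyy : finB n y ≠ finB n x := by simp [finB, hx, hy]
    refine ⟨Equiv.swap (finA n x) (finB n x) * (Equiv.swap (finA n y) (finB n y) * w),
      ?_, ?_, ?_⟩
    · rw [Equiv.Perm.mul_apply, Equiv.Perm.mul_apply, hA, hAy,
        Equiv.swap_apply_of_ne_of_ne hxx hxy, Equiv.swap_apply_left]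
    · rw [Equiv.Perm.mul_apply, Equiv.Perm.mul_apply, hB, hAy, Equiv.swap_apply_left,
        Equiv.swap_apply_of_ne_of_ne hxy.symm hyy]
    · have hbraid : dg n x * sg n y * sg n x = sg n y * sg n x * dg n y :=
        dg_mul_sg_mul_sg (Or.inl rfl)
      have hmove : sg n x * sg n y * dg n x = dg n y * sg n x * sg n y := by
        calc sg n x * sg n y * dg n x
            = sg n x * sg n y * dg n x * (sg n y * (sg n x * sg n x) * sg n y) := by
              simp [sg_mul_self]
          _ = sg n x * sg n y * (dg n x * sg n y * sg n x) * sg n x * sg n y := by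
              simp only [mul_assoc]
          _ = sg n x * (sg n y * sg n y) * sg n x * dg n y * sg n x * sg n y := by
              rw [hbraid]; simp only [mul_assoc]
          _ = dg n y * sg n x * sg n y := by simp [sg_mul_self]
      rw [map_mul, map_mul, Units.val_mul, Units.val_mul, hπ, hπ]
      calc sg n x * (sg n y * (π w : HH n)) * dg n (firstIndex hn)
          = sg n x * sg n y * ((π w : HH n) * dg n (firstIndex hn)) := by
            simp only [mul_assoc]
        _ = sg n x * sg n y * dg n x * (π w : HH n) := by rw [hw]; simp only [mul_assoc]
        _ = dg n y * (sg n x * (sg n y * (π w : HH n))) := by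
            rw [hmove]; simp only [mul_assoc]

/-- For every `n ≥ 2` there exists a unique family `D_{ij} ∈ H(Sₙ)`,
`1 ≤ i < j ≤ n`, with `D_{i,i+1} = Dᵢ` and `π(w)·D_{ij}·π(w)⁻¹ = D_{w(i),w(j)}` for every
permutation `w ∈ Sₙ` and every `i < j` with `w(i) < w(j)`;  here `π : Sₙ → H(Sₙ)` is the
canonical monoid homomorphism with `π(sᵢ) = sᵢ` (landing in units). -/
theorem exists_unique_Dij (n : ℕ) (hn : 2 ≤ n)
    (π : Equiv.Perm (Fin n) →* (HH n)ˣ)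
    (hπ : ∀ i : Fin (n - 1),
      ((π (Equiv.swap (finA n i) (finB n i)) : (HH n)ˣ) : HH n) = sg n i) :
    ∃! Dij : PairLT n → HH n,
      (∀ i : Fin (n - 1), Dij (pairOf n i) = dg n i) ∧
      (∀ (w : Equiv.Perm (Fin n)) (p : PairLT n) (h : w p.1.1 < w p.1.2),
        ((π w : (HH n)ˣ) : HH n) * Dij p * (((π w)⁻¹ : (HH n)ˣ) : HH n) =
          Dij ⟨(w p.1.1, w p.1.2), h⟩) := by
  have hne : finA n (firstIndex hn) ≠ finB n (firstIndex hn) := by simp [finA, finB]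
  choose u huA huB using fun p : PairLT n => exists_perm_map_pair hne p.2.ne
  refine ⟨fun p => (π (u p) : HH n) * dg n (firstIndex hn) * (((π (u p))⁻¹ : (HH n)ˣ) : HH n),
    ⟨fun i => ?_, fun w p h => ?_⟩, fun E ⟨hE, hconj⟩ => funext fun p => ?_⟩
  · obtain ⟨w, hA, hB, hw⟩ := exists_conj_dg_first_eq_dg hn hπ i
    refine (conj_dg_first_eq hn hπ ((huA _).trans hA.symm) ((huB _).trans hB.symm)).trans ?_
    rw [hw, Units.mul_inv_cancel_right]
  · refine Eq.trans ?_ (conj_dg_first_eq (v := w * u p) hn hπ ?_ ?_)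
    · simp only [map_mul, mul_inv_rev, Units.val_mul, mul_assoc]
    · exact (congrArg w (huA p)).trans (huA ⟨(w p.1.1, w p.1.2), h⟩).symm
    · exact (congrArg w (huB p)).trans (huB ⟨(w p.1.1, w p.1.2), h⟩).symm
  · have hlt : u p (pairOf n (firstIndex hn)).1.1 < u p (pairOf n (firstIndex hn)).1.2 := by
      simpa only [pairOf, huA, huB] using p.2
    have hp : (⟨(u p (pairOf n (firstIndex hn)).1.1, u p (pairOf n (firstIndex hn)).1.2), hlt⟩ :
        PairLT n) = p := Subtype.ext (Prod.ext (huA p) (huB p))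
    have key := hconj (u p) (pairOf n (firstIndex hn)) hlt
    rw [hE, hp] at key
    exact key.symm

end HeckeHopfSn
end

section
/- For every n ≥ 2, the ℤ-algebra homomorphism from A_n to H(S_n) sending e_{ij} ↦ D_{ij} is well defined (the listed relations hold among the D_{ij} in H(S_n)) and injective, and its image equals D(S_n); in other words, D(S_n) is presented by the generators D_{ij}, 1 ≤ i < j ≤ n, subject exactly to those relations. -/
open scoped TensorProduct

namespace HeckeHopfSn

noncomputable def fe (n : ℕ) (p : PairLT n) : FreeAlgebra ℤ (PairLT n) := FreeAlgebra.ι ℤ p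

/-- The defining relations of the algebra `Aₙ` (the deformed Fomin-Kirillov algebra). -/
inductive ARel (n : ℕ) : FreeAlgebra ℤ (PairLT n) → FreeAlgebra ℤ (PairLT n) → Prop
  | idem (p : PairLT n) : ARel n (fe n p * fe n p) (fe n p)
  | comm (p p' : PairLT n) :
      p.1.1 ≠ p'.1.1 → p.1.1 ≠ p'.1.2 → p.1.2 ≠ p'.1.1 → p.1.2 ≠ p'.1.2 →
      ARel n (fe n p * fe n p') (fe n p' * fe n p)
  | tri₁ (i j k : Fin n) (hij : i < j) (hjk : j < k) :
      ARel n (fe n ⟨(i, j), hij⟩ * fe n ⟨(j, k), hjk⟩)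
        (fe n ⟨(i, k), hij.trans hjk⟩ * fe n ⟨(i, j), hij⟩ +
          fe n ⟨(j, k), hjk⟩ * fe n ⟨(i, k), hij.trans hjk⟩ - fe n ⟨(i, k), hij.trans hjk⟩)
  | tri₂ (i j k : Fin n) (hij : i < j) (hjk : j < k) :
      ARel n (fe n ⟨(j, k), hjk⟩ * fe n ⟨(i, j), hij⟩)
        (fe n ⟨(i, j), hij⟩ * fe n ⟨(i, k), hij.trans hjk⟩ +
          fe n ⟨(i, k), hij.trans hjk⟩ * fe n ⟨(j, k), hjk⟩ - fe n ⟨(i, k), hij.trans hjk⟩)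

/-- The algebra `Aₙ` presented by generators `e_{ij}`, `1 ≤ i < j ≤ n`, and the relations
of Proposition `pr:D presentation Sn`. -/
abbrev An (n : ℕ) : Type := RingQuot (ARel n)

/-- The image of `e_{ij}` in `Aₙ`. -/
noncomputable def eg (n : ℕ) (p : PairLT n) : An n := RingQuot.mkAlgHom ℤ (ARel n) (fe n p)

/-! ### The symmetric generators of `Aₙ` -/

/-- The ring `Aₙ`, sealed so that it carries a single ring structure up to reducible unfolding. -/
def Alg (n : ℕ) : Type := An n

noncomputable instance (n : ℕ) : Ring (Alg n) := inferInstanceAs (Ring (An n))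

/-- The quotient map onto `Aₙ`. -/
noncomputable def toAlg (n : ℕ) : FreeAlgebra ℤ (PairLT n) →+* Alg n :=
  RingQuot.mkRingHom (ARel n)

theorem toAlg_surjective (n : ℕ) : Function.Surjective (toAlg n) :=
  RingQuot.mkRingHom_surjective (ARel n)

theorem toAlg_rel (n : ℕ) {x y : FreeAlgebra ℤ (PairLT n)} (h : ARel n x y) :
    toAlg n x = toAlg n y :=
  RingQuot.mkRingHom_rel h

/-- The generator `e_p` of `Aₙ`. -/
noncomputable def gen (n : ℕ) (p : PairLT n) : Alg n := toAlg n (fe n p)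

theorem gen_idem (n : ℕ) (p : PairLT n) : gen n p * gen n p = gen n p := by
  simpa [gen] using toAlg_rel n (ARel.idem p)

theorem gen_comm (n : ℕ) (p p' : PairLT n) (h₁ : p.1.1 ≠ p'.1.1) (h₂ : p.1.1 ≠ p'.1.2)
    (h₃ : p.1.2 ≠ p'.1.1) (h₄ : p.1.2 ≠ p'.1.2) : gen n p * gen n p' = gen n p' * gen n p := by
  simpa [gen] using toAlg_rel n (ARel.comm p p' h₁ h₂ h₃ h₄)

theorem gen_tri₁ (n : ℕ) (i j k : Fin n) (hij : i < j) (hjk : j < k) :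
    gen n ⟨(i, j), hij⟩ * gen n ⟨(j, k), hjk⟩ =
      gen n ⟨(i, k), hij.trans hjk⟩ * gen n ⟨(i, j), hij⟩ +
        gen n ⟨(j, k), hjk⟩ * gen n ⟨(i, k), hij.trans hjk⟩ - gen n ⟨(i, k), hij.trans hjk⟩ := by
  simpa [gen] using toAlg_rel n (ARel.tri₁ i j k hij hjk)

theorem gen_tri₂ (n : ℕ) (i j k : Fin n) (hij : i < j) (hjk : j < k) :
    gen n ⟨(j, k), hjk⟩ * gen n ⟨(i, j), hij⟩ =
      gen n ⟨(i, j), hij⟩ * gen n ⟨(i, k), hij.trans hjk⟩ +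
        gen n ⟨(i, k), hij.trans hjk⟩ * gen n ⟨(j, k), hjk⟩ - gen n ⟨(i, k), hij.trans hjk⟩ := by
  simpa [gen] using toAlg_rel n (ARel.tri₂ i j k hij hjk)

/-- The generators of `Aₙ` indexed by all pairs, with `e_{ji} = 1 - e_{ij}`. -/
noncomputable def eAll (n : ℕ) (a b : Fin n) : Alg n :=
  if h : a < b then gen n ⟨(a, b), h⟩ else if h : b < a then 1 - gen n ⟨(b, a), h⟩ else 0

theorem eAll_of_lt (n : ℕ) {a b : Fin n} (h : a < b) : eAll n a b = gen n ⟨(a, b), h⟩ := by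
  simp [eAll, h]

theorem eAll_pair (n : ℕ) (p : PairLT n) : eAll n p.1.1 p.1.2 = gen n p := eAll_of_lt n p.2

theorem eAll_symm (n : ℕ) {a b : Fin n} (h : a ≠ b) : eAll n b a = 1 - eAll n a b := by
  rcases lt_or_gt_of_ne h with h | h <;> simp [eAll, h, h.not_gt]

theorem eAll_idem (n : ℕ) (a b : Fin n) : eAll n a b * eAll n a b = eAll n a b := by
  unfold eAll
  split_ifs with h h
  · exact gen_idem n _
  · have := gen_idem n ⟨(b, a), h⟩
    linear_combination (norm := noncomm_ring) this
  · simp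

theorem eAll_comm (n : ℕ) {a b c d : Fin n} (h₁ : a ≠ c) (h₂ : a ≠ d) (h₃ : b ≠ c)
    (h₄ : b ≠ d) : eAll n a b * eAll n c d = eAll n c d * eAll n a b := by
  unfold eAll
  split_ifs with p q q p q q
  · exact gen_comm n _ _ h₁ h₂ h₃ h₄
  · have := gen_comm n ⟨(a, b), p⟩ ⟨(d, c), q⟩ h₂ h₁ h₄ h₃
    linear_combination (norm := noncomm_ring) this.symm
  · simp
  · have := gen_comm n ⟨(b, a), p⟩ ⟨(c, d), q⟩ h₃ h₄ h₁ h₂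
    linear_combination (norm := noncomm_ring) this.symm
  · have := gen_comm n ⟨(b, a), p⟩ ⟨(d, c), ‹_›⟩ h₄ h₃ h₂ h₁
    linear_combination (norm := noncomm_ring) this
  all_goals simp

/-- The triangle relations of `Aₙ` in cyclically symmetric form. -/
theorem eAll_cyclic (n : ℕ) {a b c : Fin n} (hab : a ≠ b) (hbc : b ≠ c) (hac : a ≠ c) :
    eAll n a b * eAll n b c + eAll n c a * eAll n a b + eAll n b c * eAll n c a =
      eAll n a b + eAll n b c + eAll n c a - 1 := by
  have tri₁ : ∀ {i j k : Fin n}, i < j → j < k →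
      eAll n i j * eAll n j k + eAll n k i * eAll n i j + eAll n j k * eAll n k i =
        eAll n i j + eAll n j k + eAll n k i - 1 := by
    intro i j k hij hjk
    rw [eAll_symm n (hij.trans hjk).ne, eAll_of_lt n hij, eAll_of_lt n hjk,
      eAll_of_lt n (hij.trans hjk)]
    linear_combination (norm := noncomm_ring) gen_tri₁ n i j k hij hjk
  have tri₂ : ∀ {i j k : Fin n}, i < j → j < k →
      eAll n k j * eAll n j i + eAll n i k * eAll n k j + eAll n j i * eAll n i k =
        eAll n k j + eAll n j i + eAll n i k - 1 := by
    intro i j k hij hjk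
    rw [eAll_symm n hij.ne, eAll_symm n hjk.ne, eAll_of_lt n hij, eAll_of_lt n hjk,
      eAll_of_lt n (hij.trans hjk)]
    linear_combination (norm := noncomm_ring) gen_tri₂ n i j k hij hjk
  rcases lt_or_gt_of_ne hab with h₁ | h₁ <;> rcases lt_or_gt_of_ne hbc with h₂ | h₂
  · exact tri₁ h₁ h₂
  · rcases lt_or_gt_of_ne hac with h₃ | h₃
    · linear_combination (norm := abel) tri₂ h₃ h₂
    · linear_combination (norm := abel) tri₁ h₃ h₁
  · rcases lt_or_gt_of_ne hac with h₃ | h₃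
    · linear_combination (norm := abel) tri₂ h₁ h₃
    · linear_combination (norm := abel) tri₁ h₂ h₃
  · exact tri₂ h₂ h₁

theorem eAll_tri (n : ℕ) {a b c : Fin n} (hab : a ≠ b) (hbc : b ≠ c) (hac : a ≠ c) :
    eAll n a b * eAll n b c =
      eAll n a c * eAll n a b + eAll n b c * eAll n a c - eAll n a c := by
  have h := eAll_cyclic n hab hbc hac
  rw [eAll_symm n hac] at h
  linear_combination (norm := noncomm_ring) h

theorem eAll_tri' (n : ℕ) {a b c : Fin n} (hab : a ≠ b) (hbc : b ≠ c) (hac : a ≠ c) :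
    eAll n b c * eAll n a b =
      eAll n a b * eAll n a c + eAll n a c * eAll n b c - eAll n a c := by
  have h := eAll_cyclic n hbc.symm hab.symm hac.symm
  rw [eAll_symm n hab, eAll_symm n hbc] at h
  linear_combination (norm := noncomm_ring) h

theorem submodule_eq_top (n : ℕ) (K : Submodule ℤ (Alg n)) (h1 : (1 : Alg n) ∈ K)
    (h : ∀ p, ∀ a ∈ K, gen n p * a ∈ K) : K = ⊤ := by
  have key : ∀ f : FreeAlgebra ℤ (PairLT n), ∀ a ∈ K,
      toAlg n f * a ∈ K := by
    intro f
    induction f using FreeAlgebra.induction with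
    | grade0 r =>
      intro a ha
      rw [eq_intCast, map_intCast, ← zsmul_eq_mul]
      exact K.smul_mem _ ha
    | grade1 p => exact h p
    | mul x y hx hy =>
      intro a ha
      rw [map_mul, mul_assoc]
      exact hx _ (hy _ ha)
    | add x y hx hy =>
      intro a ha
      rw [map_add, add_mul]
      exact K.add_mem (hx _ ha) (hy _ ha)
  refine Submodule.eq_top_iff'.2 fun x => ?_
  obtain ⟨f, rfl⟩ := toAlg_surjective n x
  simpa using key f 1 h1

/-- To check that two endomorphisms agree, compare them at `1` and propagate along left
multiplication by generators. -/
theorem end_ext (n : ℕ) {X Y : Module.End ℤ (Alg n)} (h1 : X 1 = Y 1)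
    (h : ∀ p a, X a = Y a → X (gen n p * a) = Y (gen n p * a)) : X = Y := by
  have := submodule_eq_top n (LinearMap.eqLocus X Y) h1 h
  exact LinearMap.eqLocus_eq_top.1 this

/-! ### The action of `sᵢ` on `Aₙ` -/

/-- The simple transposition `(i, i+1)`. -/
def sw (n : ℕ) (i : Fin (n - 1)) : Equiv.Perm (Fin n) := Equiv.swap (finA n i) (finB n i)

/-- The coefficient of the correction term in the commutation of `sᵢ` with `e_{ab}`,
where `(c, d) = (i, i+1)`. -/
def corr {n : ℕ} (c d a b : Fin n) : ℤ :=
  if a = c ∧ b = d then -1 else if a = d ∧ b = c then 1 else 0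

theorem corr_perm {n : ℕ} (w : Equiv.Perm (Fin n)) (c d a b : Fin n) :
    corr (w c) (w d) (w a) (w b) = corr c d a b := by
  simp [corr]

theorem finA_ne_finB (n : ℕ) (i : Fin (n - 1)) : finA n i ≠ finB n i := by
  simp [finA, finB]

theorem sw_finA (n : ℕ) (i : Fin (n - 1)) : sw n i (finA n i) = finB n i :=
  Equiv.swap_apply_left _ _

theorem sw_finB (n : ℕ) (i : Fin (n - 1)) : sw n i (finB n i) = finA n i :=
  Equiv.swap_apply_right _ _

theorem sw_sw (n : ℕ) (i : Fin (n - 1)) (a : Fin n) : sw n i (sw n i a) = a :=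
  Equiv.swap_apply_self _ _ _

theorem sw_of_ne (n : ℕ) (i : Fin (n - 1)) {a : Fin n} (h₁ : a ≠ finA n i)
    (h₂ : a ≠ finB n i) : sw n i a = a :=
  Equiv.swap_apply_of_ne_of_ne h₁ h₂

/-- The upper triangular matrix encoding the twisted Leibniz rule of `sᵢ` at `e_p`. -/
noncomputable def twistGen (n : ℕ) (i : Fin (n - 1)) (p : PairLT n) :
    Matrix (Fin 2) (Fin 2) (Alg n) :=
  !![eAll n (sw n i p.1.1) (sw n i p.1.2),
      ((corr (finA n i) (finB n i) p.1.1 p.1.2 : ℤ) : Alg n);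
    0, eAll n p.1.1 p.1.2]

theorem corr_of_lt {n : ℕ} (i : Fin (n - 1)) {a b : Fin n} (h : a < b) :
    corr (finA n i) (finB n i) a b = if a = finA n i ∧ b = finB n i then -1 else 0 := by
  have : ¬ (a = finB n i ∧ b = finA n i) := by
    rintro ⟨rfl, rfl⟩
    simp [finA, finB, Fin.lt_def] at h
  simp [corr, this]

theorem twistGen_rel (n : ℕ) (i : Fin (n - 1)) ⦃x y : FreeAlgebra ℤ (PairLT n)⦄
    (h : ARel n x y) :
    FreeAlgebra.lift ℤ (twistGen n i) x = FreeAlgebra.lift ℤ (twistGen n i) y := by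
  have inj : ∀ {a b : Fin n}, a ≠ b → sw n i a ≠ sw n i b := fun h => (sw n i).injective.ne h
  have lift_fe : ∀ p : PairLT n, FreeAlgebra.lift ℤ (twistGen n i) (fe n p) =
      !![eAll n (sw n i p.1.1) (sw n i p.1.2),
        ((if p.1.1 = finA n i ∧ p.1.2 = finB n i then -1 else 0 : ℤ) : Alg n);
        0, eAll n p.1.1 p.1.2] := by
    intro p
    rw [← corr_of_lt i p.2]
    exact FreeAlgebra.lift_ι_apply _ _
  have lift_fe' : ∀ (a b : Fin n) (h : a < b),
      FreeAlgebra.lift ℤ (twistGen n i) (fe n ⟨(a, b), h⟩) =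
      !![eAll n (sw n i a) (sw n i b),
        ((if a = finA n i ∧ b = finB n i then -1 else 0 : ℤ) : Alg n);
        0, eAll n a b] := fun a b h => lift_fe ⟨(a, b), h⟩
  induction h with
  | idem p =>
    have hne : p.1.1 ≠ p.1.2 := p.2.ne
    simp only [map_mul, lift_fe, Matrix.mul_fin_two, eAll_idem]
    generalize p.1.1 = a at *
    generalize p.1.2 = b at *
    by_cases h : a = finA n i ∧ b = finB n i
    · obtain ⟨rfl, rfl⟩ := h
      simp [sw_finA, sw_finB, eAll_symm n hne]
      abel
    · simp [h]
  | comm p p' h₁ h₂ h₃ h₄ =>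
    have hne : p.1.1 ≠ p.1.2 := p.2.ne
    simp only [map_mul, lift_fe, Matrix.mul_fin_two, eAll_comm n h₁ h₂ h₃ h₄,
      eAll_comm n (inj h₁) (inj h₂) (inj h₃) (inj h₄)]
    generalize p.1.1 = a at *
    generalize p.1.2 = b at *
    generalize p'.1.1 = c at *
    generalize p'.1.2 = d at *
    by_cases h : a = finA n i ∧ b = finB n i
    · obtain ⟨rfl, rfl⟩ := h
      simp [h₁.symm, sw_of_ne n i h₁.symm h₃.symm, sw_of_ne n i h₂.symm h₄.symm]
    · by_cases h' : c = finA n i ∧ d = finB n i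
      · obtain ⟨rfl, rfl⟩ := h'
        simp [h₁, sw_of_ne n i h₁ h₂, sw_of_ne n i h₃ h₄]
      · simp [h, h']
  | tri₁ a b c hab hbc =>
    have hac := hab.trans hbc
    have hn : ¬ (a = finA n i ∧ c = finB n i) := by
      rintro ⟨rfl, rfl⟩
      simp only [finA, finB, Fin.lt_def] at hab hbc
      omega
    simp only [map_mul, map_add, map_sub, lift_fe', Matrix.mul_fin_two,
      eAll_tri n hab.ne hbc.ne hac.ne, eAll_tri n (inj hab.ne) (inj hbc.ne) (inj hac.ne)]
    by_cases h : a = finA n i ∧ b = finB n i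
    · obtain ⟨rfl, rfl⟩ := h
      simp [hab.ne', hbc.ne', sw_finA, sw_finB, sw_of_ne n i hac.ne' hbc.ne']
    · by_cases h' : b = finA n i ∧ c = finB n i
      · obtain ⟨rfl, rfl⟩ := h'
        simp [hab.ne, hbc.ne, sw_finA, sw_finB, sw_of_ne n i hab.ne hac.ne]
      · simp [h, h', hn]
  | tri₂ a b c hab hbc =>
    have hac := hab.trans hbc
    have hn : ¬ (a = finA n i ∧ c = finB n i) := by
      rintro ⟨rfl, rfl⟩
      simp only [finA, finB, Fin.lt_def] at hab hbc
      omega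
    simp only [map_mul, map_add, map_sub, lift_fe', Matrix.mul_fin_two,
      eAll_tri' n hab.ne hbc.ne hac.ne, eAll_tri' n (inj hab.ne) (inj hbc.ne) (inj hac.ne)]
    by_cases h : a = finA n i ∧ b = finB n i
    · obtain ⟨rfl, rfl⟩ := h
      simp [hab.ne', hbc.ne', sw_finA, sw_finB, sw_of_ne n i hac.ne' hbc.ne']
    · by_cases h' : b = finA n i ∧ c = finB n i
      · obtain ⟨rfl, rfl⟩ := h'
        simp [hab.ne, hbc.ne, sw_finA, sw_finB, sw_of_ne n i hab.ne hac.ne]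
      · simp [h, h', hn]

/-- The ring homomorphism `a ↦ !![sᵢ(a), ∂ᵢ(a); 0, a]`, where `∂ᵢ` is a twisted derivation. -/
noncomputable def twist (n : ℕ) (i : Fin (n - 1)) : Alg n →+* Matrix (Fin 2) (Fin 2) (Alg n) :=
  RingQuot.lift ⟨(FreeAlgebra.lift ℤ (twistGen n i) : FreeAlgebra ℤ (PairLT n) →+* _),
    twistGen_rel n i⟩

theorem twist_gen (n : ℕ) (i : Fin (n - 1)) (p : PairLT n) :
    twist n i (gen n p) = twistGen n i p :=
  (RingQuot.lift_mkRingHom_apply _ (twistGen_rel n i) _).trans (FreeAlgebra.lift_ι_apply _ _)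

theorem twist_snd_row (n : ℕ) (i : Fin (n - 1)) (x : Alg n) :
    twist n i x 1 0 = 0 ∧ twist n i x 1 1 = x := by
  let K : Submodule ℤ (Alg n) :=
    { carrier := {x | twist n i x 1 0 = 0 ∧ twist n i x 1 1 = x}
      add_mem' := by
        rintro a b ⟨ha, ha'⟩ ⟨hb, hb'⟩
        simp [ha, ha', hb, hb']
      zero_mem' := by simp
      smul_mem' := by
        rintro c a ⟨ha, ha'⟩
        refine ⟨?_, ?_⟩ <;> simp [map_zsmul, Matrix.smul_apply, ha, ha', -zsmul_eq_mul] }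
  have hK : K = ⊤ := by
    refine submodule_eq_top n K ?_ ?_
    · simp [K]
    · rintro p a ⟨ha, ha'⟩
      simp [K, twist_gen, twistGen, Matrix.mul_apply, Fin.sum_univ_two, ha, ha', eAll_pair]
  exact (hK ▸ Submodule.mem_top : x ∈ K)

/-- The operator by which `sᵢ` acts on `Aₙ`. -/
noncomputable def sOp (n : ℕ) (i : Fin (n - 1)) : Module.End ℤ (Alg n) :=
  AddMonoidHom.toIntLinearMap
    { toFun := fun x => twist n i x 0 0 + twist n i x 0 1
      map_zero' := by simp
      map_add' := fun x y => by simp only [map_add, Matrix.add_apply]; abel }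

theorem sOp_apply (n : ℕ) (i : Fin (n - 1)) (x : Alg n) :
    sOp n i x = twist n i x 0 0 + twist n i x 0 1 := rfl

theorem sOp_one (n : ℕ) (i : Fin (n - 1)) : sOp n i 1 = 1 := by
  simp [sOp_apply]

theorem sOp_gen_mul (n : ℕ) (i : Fin (n - 1)) (p : PairLT n) (x : Alg n) :
    sOp n i (gen n p * x) = eAll n (sw n i p.1.1) (sw n i p.1.2) * sOp n i x +
      corr (finA n i) (finB n i) p.1.1 p.1.2 • x := by
  simp only [sOp_apply, map_mul, twist_gen, twistGen, Matrix.mul_apply, Fin.sum_univ_two,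
    twist_snd_row, zsmul_eq_mul]
  simp
  noncomm_ring

theorem corr_swap {n : ℕ} {c d : Fin n} (h : c ≠ d) (a b : Fin n) :
    corr c d b a = - corr c d a b := by
  unfold corr
  split_ifs <;> simp_all

theorem sOp_eAll_mul (n : ℕ) (i : Fin (n - 1)) {a b : Fin n} (h : a ≠ b) (x : Alg n) :
    sOp n i (eAll n a b * x) = eAll n (sw n i a) (sw n i b) * sOp n i x +
      corr (finA n i) (finB n i) a b • x := by
  have of_lt : ∀ {a b : Fin n}, a < b → ∀ x, sOp n i (eAll n a b * x) =
      eAll n (sw n i a) (sw n i b) * sOp n i x + corr (finA n i) (finB n i) a b • x := by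
    intro a b hab x
    rw [eAll_of_lt n hab]
    exact sOp_gen_mul n i ⟨(a, b), hab⟩ x
  rcases lt_or_gt_of_ne h with h' | h'
  · exact of_lt h' x
  · rw [eAll_symm n h.symm, eAll_symm n ((sw n i).injective.ne h.symm), sub_mul, one_mul, map_sub,
      of_lt h', corr_swap (finA_ne_finB n i)]
    simp only [neg_smul, sub_mul, one_mul]
    abel

theorem sOp_sOp_eAll_mul (n : ℕ) (i j : Fin (n - 1)) {a b : Fin n} (h : a ≠ b) (x : Alg n) :
    sOp n i (sOp n j (eAll n a b * x)) =
      eAll n (sw n i (sw n j a)) (sw n i (sw n j b)) * sOp n i (sOp n j x) +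
      corr (finA n i) (finB n i) (sw n j a) (sw n j b) • sOp n j x +
      corr (finA n j) (finB n j) a b • sOp n i x := by
  rw [sOp_eAll_mul n j h, map_add, sOp_eAll_mul n i ((sw n j).injective.ne h), map_zsmul]

theorem sOp_sq (n : ℕ) (i : Fin (n - 1)) : sOp n i * sOp n i = 1 := by
  refine end_ext n (by simp [sOp_one]) fun p a ha => ?_
  simp only [Module.End.mul_apply, Module.End.one_apply] at ha ⊢
  have hc : corr (finA n i) (finB n i) (sw n i p.1.1) (sw n i p.1.2) =
      - corr (finA n i) (finB n i) p.1.1 p.1.2 := by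
    rw [← corr_swap (finA_ne_finB n i), ← corr_perm (sw n i) _ _ p.1.2 p.1.1, sw_finA, sw_finB]
    unfold corr
    grind
  rw [← eAll_pair, sOp_sOp_eAll_mul n i i p.2.ne, ha, hc, sw_sw, sw_sw]
  simp

theorem sOp_sOp (n : ℕ) (i : Fin (n - 1)) (x : Alg n) : sOp n i (sOp n i x) = x :=
  LinearMap.congr_fun (sOp_sq n i) x

theorem sw_val (n : ℕ) (i : Fin (n - 1)) (a : Fin n) :
    (sw n i a : ℕ) = if (a : ℕ) = i then (i : ℕ) + 1 else if (a : ℕ) = i + 1 then (i : ℕ)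
      else a := by
  simp only [sw, Equiv.swap_apply_def, Fin.ext_iff, finA, finB]
  split_ifs <;> rfl

theorem sw_finA_of_dist {n : ℕ} {i j : Fin (n - 1)} (h : Dist n i j) :
    sw n i (finA n j) = finA n j := by
  apply sw_of_ne <;> simp only [ne_eq, Fin.ext_iff, finA, finB, Dist] at * <;> omega

theorem sw_finB_of_dist {n : ℕ} {i j : Fin (n - 1)} (h : Dist n i j) :
    sw n i (finB n j) = finB n j := by
  apply sw_of_ne <;> simp only [ne_eq, Fin.ext_iff, finA, finB, Dist] at * <;> omega

theorem sw_comm_of_dist {n : ℕ} {i j : Fin (n - 1)} (h : Dist n i j) (a : Fin n) :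
    sw n i (sw n j a) = sw n j (sw n i a) := by
  ext; simp only [sw_val, Dist] at *; split_ifs <;> omega

theorem sw_sw_finA_of_adj {n : ℕ} {i j : Fin (n - 1)} (h : Adj n i j) :
    sw n j (sw n i (finA n j)) = finA n i := by
  ext; simp only [sw_val, finA, Adj] at *; split_ifs <;> omega

theorem sw_sw_finB_of_adj {n : ℕ} {i j : Fin (n - 1)} (h : Adj n i j) :
    sw n j (sw n i (finB n j)) = finB n i := by
  ext; simp only [sw_val, finB, Adj] at *; split_ifs <;> omega

theorem sw_finA_of_adj {n : ℕ} {i j : Fin (n - 1)} (h : Adj n i j) :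
    sw n i (finA n j) = sw n j (finA n i) := by
  rw [← sw_sw_finA_of_adj h, sw_sw]

theorem sw_finB_of_adj {n : ℕ} {i j : Fin (n - 1)} (h : Adj n i j) :
    sw n i (finB n j) = sw n j (finB n i) := by
  rw [← sw_sw_finB_of_adj h, sw_sw]

theorem sw_braid {n : ℕ} {i j : Fin (n - 1)} (h : Adj n i j) (a : Fin n) :
    sw n i (sw n j (sw n i a)) = sw n j (sw n i (sw n j a)) := by
  have conj : ∀ i j : Fin (n - 1), sw n i (sw n j (sw n i a)) =
      Equiv.swap (sw n i (finA n j)) (sw n i (finB n j)) a := by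
    intro i j
    rw [Equiv.swap_apply_apply]
    simp [sw]
  rw [conj, conj, sw_finA_of_adj h, sw_finB_of_adj h]

theorem corr_of_adj {n : ℕ} {i j : Fin (n - 1)} (h : Adj n i j) :
    corr (finA n i) (finB n i) (finA n j) (finB n j) = 0 := by
  simp only [corr, Fin.ext_iff, finA, finB, Adj] at *; split_ifs <;> omega

theorem corr_of_dist {n : ℕ} {i j : Fin (n - 1)} (h : Dist n i j) :
    corr (finA n i) (finB n i) (finA n j) (finB n j) = 0 := by
  simp only [corr, Fin.ext_iff, finA, finB, Dist] at *; split_ifs <;> omega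

theorem corr_sw_of_adj {n : ℕ} {i j : Fin (n - 1)} (h : Adj n i j) :
    corr (finA n j) (finB n j) (sw n i (finA n j)) (sw n i (finB n j)) = 0 := by
  simp only [corr, Fin.ext_iff, sw_val, finA, finB, Adj] at *; split_ifs <;> omega

theorem sOp_comm (n : ℕ) {i j : Fin (n - 1)} (h : Dist n i j) :
    sOp n j * sOp n i = sOp n i * sOp n j := by
  refine end_ext n (by simp [sOp_one]) fun p a ha => ?_
  simp only [Module.End.mul_apply] at ha ⊢
  have aux : ∀ {i j : Fin (n - 1)}, Dist n i j → ∀ a b : Fin n,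
      corr (finA n j) (finB n j) (sw n i a) (sw n i b) = corr (finA n j) (finB n j) a b := by
    intro i j h a b
    conv_lhs => rw [← sw_finA_of_dist h, ← sw_finB_of_dist h, corr_perm]
  rw [← eAll_pair, sOp_sOp_eAll_mul n j i p.2.ne, sOp_sOp_eAll_mul n i j p.2.ne, ha,
    sw_comm_of_dist h, sw_comm_of_dist h, aux h, aux h.symm]
  abel

theorem sOp_braid (n : ℕ) {i j : Fin (n - 1)} (h : Adj n i j) :
    sOp n j * sOp n i * sOp n j = sOp n i * sOp n j * sOp n i := by
  refine end_ext n (by simp [sOp_one]) fun p a ha => ?_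
  simp only [Module.End.mul_apply] at ha ⊢
  have expand : ∀ i j : Fin (n - 1), ∀ {a b : Fin n}, a ≠ b → ∀ x,
      sOp n i (sOp n j (sOp n i (eAll n a b * x))) =
        eAll n (sw n i (sw n j (sw n i a))) (sw n i (sw n j (sw n i b))) *
          sOp n i (sOp n j (sOp n i x)) +
        corr (finA n i) (finB n i) (sw n j (sw n i a)) (sw n j (sw n i b)) •
          sOp n j (sOp n i x) +
        corr (finA n j) (finB n j) (sw n i a) (sw n i b) • x +
        corr (finA n i) (finB n i) a b • sOp n i (sOp n j x) := by
    intro i j a b hab x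
    rw [sOp_eAll_mul n i hab, map_add, map_add,
      sOp_sOp_eAll_mul n i j ((sw n i).injective.ne hab), sOp_sOp, map_zsmul, map_zsmul]
  have outer : ∀ {i j : Fin (n - 1)}, Adj n i j → ∀ a b : Fin n,
      corr (finA n i) (finB n i) (sw n j (sw n i a)) (sw n j (sw n i b)) =
        corr (finA n j) (finB n j) a b := by
    intro i j h a b
    rw [← sw_sw_finA_of_adj h, ← sw_sw_finB_of_adj h, corr_perm, corr_perm]
  have inner : ∀ a b : Fin n, corr (finA n j) (finB n j) (sw n i a) (sw n i b) =
      corr (finA n i) (finB n i) (sw n j a) (sw n j b) := by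
    intro a b
    rw [← corr_perm (sw n i), ← corr_perm (sw n j) (finA n i), sw_finA_of_adj h,
      sw_finB_of_adj h, sw_sw, sw_sw, sw_sw, sw_sw]
  rw [← eAll_pair, expand i j p.2.ne, expand j i p.2.ne, ha, sw_braid h, sw_braid h,
    outer h, outer h.symm, inner]
  abel

/-! ### The representation of `H(Sₙ)` on `Aₙ` -/

/-- The operator by which `Dᵢ` acts on `Aₙ`. -/
noncomputable def dOp (n : ℕ) (i : Fin (n - 1)) : Module.End ℤ (Alg n) :=
  LinearMap.mulLeft ℤ (eAll n (finA n i) (finB n i))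

/-- The operators by which the generators of `H(Sₙ)` act on `Aₙ`. -/
noncomputable def opGen (n : ℕ) : Gen n → Module.End ℤ (Alg n)
  | .s i => sOp n i
  | .D i => dOp n i

theorem dOp_apply (n : ℕ) (i : Fin (n - 1)) (x : Alg n) :
    dOp n i x = eAll n (finA n i) (finB n i) * x := rfl

theorem sOp_dOp_self (n : ℕ) (i : Fin (n - 1)) (x : Alg n) :
    sOp n i (dOp n i x) = sOp n i x - dOp n i (sOp n i x) - x := by
  have : corr (finA n i) (finB n i) (finA n i) (finB n i) = -1 := by simp [corr]
  rw [dOp_apply, dOp_apply, sOp_eAll_mul n i (finA_ne_finB n i), this, sw_finA, sw_finB,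
    eAll_symm n (finA_ne_finB n i)]
  simp only [neg_smul, one_smul, sub_mul, one_mul]
  abel

theorem opGen_rel (n : ℕ) ⦃x y : F n⦄ (h : Rel n x y) :
    FreeAlgebra.lift ℤ (opGen n) x = FreeAlgebra.lift ℤ (opGen n) y := by
  have lift_s : ∀ i, FreeAlgebra.lift ℤ (opGen n) (fs n i) = sOp n i :=
    fun i => FreeAlgebra.lift_ι_apply _ _
  have lift_D : ∀ i, FreeAlgebra.lift ℤ (opGen n) (fD n i) = dOp n i :=
    fun i => FreeAlgebra.lift_ι_apply _ _
  induction h with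
  | s_sq i => simpa [lift_s] using sOp_sq n i
  | sD i =>
    ext x
    simp [lift_s, lift_D, sOp_dOp_self]
    abel
  | D_sq i =>
    ext x
    simp [lift_D, dOp_apply, ← mul_assoc, eAll_idem]
  | ss i j h => simpa [lift_s] using sOp_comm n h
  | Ds i j h =>
    ext x
    simp [lift_s, lift_D, dOp_apply, sOp_eAll_mul n i (finA_ne_finB n j), corr_of_dist h,
      sw_finA_of_dist h, sw_finB_of_dist h]
  | DD i j h =>
    ext x
    have : eAll n (finA n j) (finB n j) * eAll n (finA n i) (finB n i) =
        eAll n (finA n i) (finB n i) * eAll n (finA n j) (finB n j) := by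
      apply eAll_comm <;> simp only [ne_eq, Fin.ext_iff, finA, finB, Dist] at * <;> omega
    simp [lift_D, dOp_apply, ← mul_assoc, this]
  | braid i j h => simpa [lift_s] using sOp_braid n h
  | braidDs i j h =>
    ext x
    simp [lift_s, lift_D, dOp_apply, sOp_sOp_eAll_mul n j i (finA_ne_finB n j), corr_of_adj h,
      corr_sw_of_adj h, sw_sw_finA_of_adj h, sw_sw_finB_of_adj h]
  | braidDsD i j h =>
    ext x
    have sd : ∀ x, sOp n i (dOp n j x) =
        eAll n (sw n i (finA n j)) (sw n i (finB n j)) * sOp n i x := by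
      intro x
      rw [dOp_apply, sOp_eAll_mul n i (finA_ne_finB n j), corr_of_adj h, zero_smul, add_zero]
    have key : eAll n (finA n j) (finB n j) * eAll n (sw n i (finA n j)) (sw n i (finB n j)) =
        eAll n (sw n i (finA n j)) (sw n i (finB n j)) -
        eAll n (sw n i (finA n j)) (sw n i (finB n j)) * eAll n (finA n i) (finB n i) +
        eAll n (finA n i) (finB n i) * eAll n (finA n j) (finB n j) := by
      rcases h with h | h
      · have hb : finA n j = finB n i := by ext; simp [finA, finB, h]
        have hne : finA n i ≠ finB n j := by simp [finA, finB, Fin.ext_iff]; omega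
        have hne' := finA_ne_finB n j
        rw [hb] at hne' ⊢
        rw [sw_finB, sw_of_ne n i hne.symm hne'.symm, eAll_tri n (finA_ne_finB n i) hne' hne]
        abel
      · have hb : finB n j = finA n i := by ext; simp [finA, finB, h]
        have hne : finA n j ≠ finB n i := by simp [finA, finB, Fin.ext_iff]; omega
        have hne' := finA_ne_finB n j
        rw [hb] at hne' ⊢
        rw [sw_finA, sw_of_ne n i hne' hne, eAll_tri' n hne' (finA_ne_finB n i) hne]
        abel
    simp only [map_mul, map_add, lift_s, lift_D, Module.End.mul_apply, LinearMap.add_apply, sd,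
      sOp_sOp, sOp_dOp_self]
    simp only [dOp_apply, ← mul_assoc, key]
    noncomm_ring

/-- The representation of `H(Sₙ)` on `Aₙ`. -/
noncomputable def rep (n : ℕ) : HH n →+* Module.End ℤ (Alg n) :=
  RingQuot.lift ⟨(FreeAlgebra.lift ℤ (opGen n) : F n →+* _), opGen_rel n⟩

theorem rep_sg (n : ℕ) (i : Fin (n - 1)) : rep n (sg n i) = sOp n i := by
  rw [sg, ← AlgHom.coe_toRingHom, RingQuot.mkAlgHom_coe]
  exact (RingQuot.lift_mkRingHom_apply _ (opGen_rel n) _).trans (FreeAlgebra.lift_ι_apply _ _)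

theorem rep_dg (n : ℕ) (i : Fin (n - 1)) : rep n (dg n i) = dOp n i := by
  rw [dg, ← AlgHom.coe_toRingHom, RingQuot.mkAlgHom_coe]
  exact (RingQuot.lift_mkRingHom_apply _ (opGen_rel n) _).trans (FreeAlgebra.lift_ι_apply _ _)

/-! ### The relations among the `Dᵢⱼ` -/

/-- Conjugation by a unit, as a ring homomorphism. -/
def conjHom {R : Type*} [Ring R] (u : Rˣ) : R →+* R where
  toFun x := u * x * ((u⁻¹ : Rˣ) : R)
  map_one' := by simp
  map_mul' x y := by simp [mul_assoc]
  map_zero' := by simp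
  map_add' x y := by simp [mul_add, add_mul]

theorem conjHom_apply {R : Type*} [Ring R] (u : Rˣ) (x : R) :
    conjHom u x = u * x * ((u⁻¹ : Rˣ) : R) := rfl

theorem triangle_of_braid {R : Type*} [Ring R] {s d d' x : R} (hs : s * s = 1)
    (hsd : s * d + d * s = s - 1) (hx : x * s = s * d')
    (hb : d' * s * d' = s * d' * d + d * d' * s + s * d' * s) :
    d * d' = x * d + d' * x - x := by
  have h : d * d' * s = (x * d + d' * x - x) * s := by
    have h₁ : d' * s * d' = d' * x * s := by rw [mul_assoc, mul_assoc, hx]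
    have h₂ : s * d' * d = x * s - x - x * d * s := by
      rw [← hx, mul_assoc, eq_sub_of_add_eq hsd]
      noncomm_ring
    have h₃ : s * d' * s = x := by rw [← hx, mul_assoc, hs, mul_one]
    rw [h₁, h₂, h₃] at hb
    linear_combination (norm := noncomm_ring) -hb
  simpa [mul_assoc, hs] using congrArg (· * s) h

theorem exists_perm_extend {n m : ℕ} (hm : m ≤ n) (f : Fin m → Fin n)
    (hf : Function.Injective f) :
    ∃ w : Equiv.Perm (Fin n), ∀ i : Fin m, w (Fin.castLE hm i) = f i := by
  have := Equiv.Perm.isMultiplyPretransitive (Fin n) m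
  obtain ⟨w, hw⟩ := MulAction.exists_smul_eq (Equiv.Perm (Fin n)) (Fin.castLEEmb hm)
    (⟨f, hf⟩ : Fin m ↪ Fin n)
  exact ⟨w, fun i => DFunLike.congr_fun hw i⟩

section Relations

variable {n : ℕ} {R : Type*} [Ring R] {π : Equiv.Perm (Fin n) →* Rˣ} {Dij : PairLT n → R}

theorem conjHom_Dij
    (hD : ∀ (w : Equiv.Perm (Fin n)) (p : PairLT n) (h : w p.1.1 < w p.1.2),
      (π w : R) * Dij p * (((π w)⁻¹ : Rˣ) : R) = Dij ⟨(w p.1.1, w p.1.2), h⟩)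
    {w : Equiv.Perm (Fin n)} {p q : PairLT n} (h₁ : w p.1.1 = q.1.1) (h₂ : w p.1.2 = q.1.2) :
    conjHom (π w) (Dij p) = Dij q := by
  have h : w p.1.1 < w p.1.2 := by rw [h₁, h₂]; exact q.2
  exact (hD w p h).trans (congrArg Dij (Subtype.ext (Prod.ext h₁ h₂)))

theorem Dij_rel (hn : 2 ≤ n) {s d : Fin (n - 1) → R}
    (hs : ∀ i, s i * s i = 1) (hsd : ∀ i, s i * d i + d i * s i = s i - 1)
    (hd : ∀ i, d i * d i = d i) (hdd : ∀ i j, Dist n i j → d j * d i = d i * d j)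
    (hb : ∀ i j, Adj n i j →
      d j * s i * d j = s i * d j * d i + d i * d j * s i + s i * d j * s i)
    (hπ : ∀ i, (π (sw n i) : R) = s i) (hD1 : ∀ i, Dij (pairOf n i) = d i)
    (hD2 : ∀ (w : Equiv.Perm (Fin n)) (p : PairLT n) (h : w p.1.1 < w p.1.2),
      (π w : R) * Dij p * (((π w)⁻¹ : Rˣ) : R) = Dij ⟨(w p.1.1, w p.1.2), h⟩)
    ⦃x y : FreeAlgebra ℤ (PairLT n)⦄ (h : ARel n x y) :
    FreeAlgebra.lift ℤ Dij x = FreeAlgebra.lift ℤ Dij y := by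
  have lift_fe : ∀ p : PairLT n, FreeAlgebra.lift ℤ Dij (fe n p) = Dij p :=
    fun p => FreeAlgebra.lift_ι_apply _ _
  have lift_fe' : ∀ (a b : Fin n) (h : a < b),
      FreeAlgebra.lift ℤ Dij (fe n ⟨(a, b), h⟩) = Dij ⟨(a, b), h⟩ := fun a b h => lift_fe _
  have inj₃ : ∀ {a b c : Fin n}, a < b → b < c → Function.Injective ![a, b, c] := by
    intro a b c hab hbc u v
    have hac := hab.trans hbc
    fin_cases u <;> fin_cases v <;>
      simp [hab.ne, hbc.ne, hac.ne, hab.ne', hbc.ne', hac.ne']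
  have le₃ : ∀ {a b c : Fin n}, a < b → b < c → 3 ≤ n := by
    intro a b c hab hbc
    simp only [Fin.lt_def] at hab hbc
    omega
  -- A triangle `a < b < c` is a conjugate of the triangle `0 < 1 < 2`.
  have triangle : ∀ {a b c : Fin n} (hab : a < b) (hbc : b < c),
      ∃ (u : Rˣ) (i j : Fin (n - 1)) (x : R), Adj n i j ∧ x * s i = s i * d j ∧
        x * s j = s j * d i ∧ conjHom u (d i) = Dij ⟨(a, b), hab⟩ ∧
        conjHom u (d j) = Dij ⟨(b, c), hbc⟩ ∧ conjHom u x = Dij ⟨(a, c), hab.trans hbc⟩ := by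
    intro a b c hab hbc
    have h3 := le₃ hab hbc
    obtain ⟨w, hw⟩ := exists_perm_extend h3 _ (inj₃ hab hbc)
    have h0 := hw 0
    have h1 := hw 1
    have h2 := hw 2
    let i : Fin (n - 1) := ⟨0, by omega⟩
    let j : Fin (n - 1) := ⟨1, by omega⟩
    let q : PairLT n := ⟨(⟨0, by omega⟩, ⟨2, by omega⟩), by simp [Fin.lt_def]⟩
    have conj_sw : ∀ (i : Fin (n - 1)) (p : PairLT n), sw n i p.1.1 = q.1.1 →
        sw n i p.1.2 = q.1.2 → Dij q * s i = s i * Dij p := by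
      intro i p h₁ h₂
      rw [← conjHom_Dij hD2 h₁ h₂, conjHom_apply, ← hπ]
      simp [mul_assoc]
    refine ⟨π w, i, j, Dij q, Or.inl rfl, ?_, ?_, ?_, ?_, ?_⟩
    · rw [← hD1]
      apply conj_sw <;> ext <;> simp [sw_val, pairOf, finA, finB, i, j, q]
    · rw [← hD1]
      apply conj_sw <;> ext <;> simp [sw_val, pairOf, finA, finB, i, j, q]
    · rw [← hD1]
      exact conjHom_Dij hD2 h0 h1
    · rw [← hD1]
      exact conjHom_Dij hD2 h1 h2
    · exact conjHom_Dij hD2 h0 h2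
  induction h with
  | idem p =>
    have hp : p.1.1 < p.1.2 := p.2
    obtain ⟨w, hw⟩ := exists_perm_extend hn ![p.1.1, p.1.2] (by
      intro u v
      fin_cases u <;> fin_cases v <;> simp [hp.ne, hp.ne'])
    have h : conjHom (π w) (Dij (pairOf n ⟨0, by omega⟩)) = Dij p :=
      conjHom_Dij hD2 (hw 0) (hw 1)
    rw [map_mul, lift_fe, ← h, ← map_mul, hD1, hd]
  | comm p p' h₁ h₂ h₃ h₄ =>
    have hp : p.1.1 < p.1.2 := p.2
    have hp' : p'.1.1 < p'.1.2 := p'.2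
    have inj : Function.Injective ![p.1.1, p.1.2, p'.1.1, p'.1.2] := by
      intro u v
      fin_cases u <;> fin_cases v <;> simp [hp.ne, hp.ne', hp'.ne, hp'.ne', h₁, h₂, h₃, h₄,
        h₁.symm, h₂.symm, h₃.symm, h₄.symm]
    have h4 : 4 ≤ n := by simpa using Fintype.card_le_of_injective _ inj
    obtain ⟨w, hw⟩ := exists_perm_extend h4 _ inj
    have h : conjHom (π w) (Dij (pairOf n ⟨0, by omega⟩)) = Dij p :=
      conjHom_Dij hD2 (hw 0) (hw 1)
    have h' : conjHom (π w) (Dij (pairOf n ⟨2, by omega⟩)) = Dij p' :=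
      conjHom_Dij hD2 (hw 2) (hw 3)
    rw [map_mul, map_mul, lift_fe, lift_fe, ← h, ← h', ← map_mul, ← map_mul, hD1, hD1]
    exact congrArg _ (hdd _ _ (Or.inr (by simp)))
  | tri₁ a b c hab hbc =>
    obtain ⟨u, i, j, x, hij, hx, -, h₁, h₂, h₃⟩ := triangle hab hbc
    simp only [map_mul, map_add, map_sub, lift_fe']
    rw [← h₁, ← h₂, ← h₃]
    simp only [← map_mul, ← map_add, ← map_sub]
    exact congrArg _ (triangle_of_braid (hs i) (hsd i) hx (hb i j hij))
  | tri₂ a b c hab hbc =>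
    obtain ⟨u, i, j, x, hij, -, hx, h₁, h₂, h₃⟩ := triangle hab hbc
    simp only [map_mul, map_add, map_sub, lift_fe']
    rw [← h₁, ← h₂, ← h₃]
    simp only [← map_mul, ← map_add, ← map_sub]
    rw [add_comm (d i * x)]
    exact congrArg _ (triangle_of_braid (hs j) (hsd j) hx (hb j i hij.symm))

end Relations

/-- In the representation on `Aₙ`, `Dᵢⱼ` acts by left multiplication by `eᵢⱼ`. -/
theorem rep_Dij (n : ℕ) (π : Equiv.Perm (Fin n) →* (HH n)ˣ)
    (hπ : ∀ i, ((π (sw n i) : (HH n)ˣ) : HH n) = sg n i) (Dij : PairLT n → HH n)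
    (hD1 : ∀ i : Fin (n - 1), Dij (pairOf n i) = dg n i)
    (hD2 : ∀ (w : Equiv.Perm (Fin n)) (p : PairLT n) (h : w p.1.1 < w p.1.2),
      ((π w : (HH n)ˣ) : HH n) * Dij p * (((π w)⁻¹ : (HH n)ˣ) : HH n) =
        Dij ⟨(w p.1.1, w p.1.2), h⟩) (p : PairLT n) :
    rep n (Dij p) = LinearMap.mulLeft ℤ (gen n p) := by
  suffices ∀ (k : ℕ) (p : PairLT n), (p.1.2 : ℕ) = p.1.1 + k + 1 →
      rep n (Dij p) = LinearMap.mulLeft ℤ (gen n p) by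
    have hp : p.1.1 < p.1.2 := p.2
    rw [Fin.lt_def] at hp
    exact this (p.1.2 - p.1.1 - 1) p (by omega)
  intro k
  induction k with
  | zero =>
    intro p hp
    have hlt := p.1.2.2
    obtain ⟨i, rfl⟩ : ∃ i, p = pairOf n i :=
      ⟨⟨p.1.1, by omega⟩, Subtype.ext (Prod.ext rfl (Fin.ext hp))⟩
    rw [hD1, rep_dg, dOp, ← eAll_pair]
    rfl
  | succ k ih =>
    intro p hp
    have hlt := p.1.2.2
    let q : PairLT n := ⟨(p.1.1, ⟨p.1.1 + k + 1, by omega⟩), by simp [Fin.lt_def]⟩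
    let j : Fin (n - 1) := ⟨p.1.1 + k + 1, by omega⟩
    have h₁ : sw n j q.1.1 = p.1.1 := by
      ext
      simp only [sw_val, q, j]
      split_ifs <;> omega
    have h₂ : sw n j q.1.2 = p.1.2 := by
      ext
      simp only [sw_val, q, j]
      simp [hp]
      omega
    have hc : corr (finA n j) (finB n j) q.1.1 q.1.2 = 0 := by
      simp only [corr, Fin.ext_iff, finA, finB, q, j]
      split_ifs <;> omega
    have key : Dij p * sg n j = sg n j * Dij q := by
      rw [← conjHom_Dij hD2 h₁ h₂, conjHom_apply, ← hπ, mul_assoc, Units.inv_mul, mul_one]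
    have key' : rep n (Dij p) * sOp n j = LinearMap.mulLeft ℤ (gen n p) * sOp n j := by
      rw [← rep_sg, ← map_mul, key, map_mul, ih q rfl, rep_sg]
      ext x
      simp only [Module.End.mul_apply, LinearMap.mulLeft_apply]
      rw [sOp_gen_mul, hc, h₁, h₂, eAll_pair, zero_smul, add_zero]
    have h := congrArg (· * sOp n j) key'
    simpa only [mul_assoc, sOp_sq, mul_one] using h

theorem eg_eq_mkRingHom (n : ℕ) (p : PairLT n) :
    eg n p = RingQuot.mkRingHom (ARel n) (fe n p) := by
  rw [eg, ← AlgHom.coe_toRingHom, RingQuot.mkAlgHom_coe]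

/-- For every `n ≥ 2`, the `ℤ`-algebra homomorphism `Aₙ → H(Sₙ)`,
`e_{ij} ↦ D_{ij}`, is well defined and injective, and its image is `D(Sₙ)`; i.e. `D(Sₙ)`
is presented by the generators `D_{ij}` subject exactly to the listed relations. -/
theorem D_presentation (n : ℕ) (hn : 2 ≤ n)
    (π : Equiv.Perm (Fin n) →* (HH n)ˣ)
    (hπ : ∀ i : Fin (n - 1),
      ((π (Equiv.swap (finA n i) (finB n i)) : (HH n)ˣ) : HH n) = sg n i)
    (Dij : PairLT n → HH n)
    (hD1 : ∀ i : Fin (n - 1), Dij (pairOf n i) = dg n i)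
    (hD2 : ∀ (w : Equiv.Perm (Fin n)) (p : PairLT n) (h : w p.1.1 < w p.1.2),
      ((π w : (HH n)ˣ) : HH n) * Dij p * (((π w)⁻¹ : (HH n)ˣ) : HH n) =
        Dij ⟨(w p.1.1, w p.1.2), h⟩) :
    ∃ φ : An n →ₐ[ℤ] HH n,
      (∀ p : PairLT n, φ (eg n p) = Dij p) ∧
      Function.Injective φ ∧
      φ.range = Algebra.adjoin ℤ (Set.range Dij) := by
  have rel : ∀ {x y : F n}, Rel n x y →
      RingQuot.mkAlgHom ℤ (Rel n) x = RingQuot.mkAlgHom ℤ (Rel n) y :=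
    fun h => RingQuot.mkAlgHom_rel ℤ h
  have hrel := Dij_rel (s := sg n) (d := dg n) hn
    (fun i => by simpa [sg] using rel (.s_sq i))
    (fun i => by simpa [sg, dg] using rel (.sD i))
    (fun i => by simpa [dg] using rel (.D_sq i))
    (fun i j h => by simpa [dg] using rel (.DD i j h))
    (fun i j h => by simpa [sg, dg] using rel (.braidDsD i j h)) hπ hD1 hD2
  let φ : An n →+* HH n :=
    RingQuot.lift ⟨(FreeAlgebra.lift ℤ Dij : FreeAlgebra ℤ (PairLT n) →+* HH n), hrel⟩
  have hφ : ∀ p, φ (eg n p) = Dij p := by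
    intro p
    rw [eg_eq_mkRingHom]
    exact (RingQuot.lift_mkRingHom_apply _ hrel _).trans (FreeAlgebra.lift_ι_apply _ _)
  have left : ∀ x : FreeAlgebra ℤ (PairLT n),
      rep n (φ (RingQuot.mkRingHom (ARel n) x)) = LinearMap.mulLeft ℤ (toAlg n x) := by
    intro x
    induction x using FreeAlgebra.induction with
    | grade0 r => ext; simp
    | grade1 p =>
      have h := rep_Dij n π hπ Dij hD1 hD2 p
      rw [← hφ, eg_eq_mkRingHom] at h
      exact h
    | mul x y hx hy =>
      rw [map_mul, map_mul, map_mul, hx, hy, map_mul]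
      ext; simp
    | add x y hx hy =>
      rw [map_add, map_add, map_add, hx, hy, map_add]
      ext; simp [add_mul]
  refine ⟨φ.toIntAlgHom, hφ, fun x y hxy => ?_, ?_⟩
  · obtain ⟨a, rfl⟩ := RingQuot.mkRingHom_surjective (ARel n) x
    obtain ⟨b, rfl⟩ := RingQuot.mkRingHom_surjective (ARel n) y
    have h : rep n (φ _) 1 = rep n (φ _) 1 := congrArg (fun z => rep n z 1) hxy
    rw [left, left, LinearMap.mulLeft_apply, LinearMap.mulLeft_apply, mul_one, mul_one] at h
    exact h
  · refine le_antisymm ?_ (Algebra.adjoin_le ?_)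
    · rintro _ ⟨x, rfl⟩
      obtain ⟨a, rfl⟩ := RingQuot.mkRingHom_surjective (ARel n) x
      have h : φ (RingQuot.mkRingHom (ARel n) a) = FreeAlgebra.lift ℤ Dij a :=
        RingQuot.lift_mkRingHom_apply _ hrel a
      change φ _ ∈ _
      rw [h, Algebra.adjoin_range_eq_range_freeAlgebra_lift]
      exact ⟨a, rfl⟩
    · rintro _ ⟨p, rfl⟩
      exact ⟨eg n p, hφ p⟩

end HeckeHopfSn
end
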